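/- Let s ≥ 2 and m ≥ 0. Then Γ_{2s+m}^{[s,s+m]×(2s+m)} = 3·2^{6s+3m−5}. Equivalently, exactly 3/8 of all square (2s+m)×(2s+m) double persymmetric matrices (stacks of an s-row and an (s+m)-row Hankel matrix over F_2) are invertible. -/

import Mathlib

open Matrix

/-- The `a × k` Hankel (persymmetric) matrix over `F_2` whose `(i,j)` entry is `α (i+j)`. -/
def hankel (a k : ℕ) (α : Fin (a + k - 1) → ZMod 2) :
    Matrix (Fin a) (Fin k) (ZMod 2) :=
  Matrix.of fun i j => α ⟨(i : ℕ) + (j : ℕ), by have := i.isLt; have := j.isLt; omega⟩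

/-- `Γ_i^{[a,b]×k}` : the number of pairs `(α, β)` such that the `(a+b) × k` matrix obtained
by stacking the `a × k` Hankel matrix of `α` on top of the `b × k` Hankel matrix of `β`
has rank `i` over `F_2`. -/
noncomputable def Gamma (a b k i : ℕ) : ℕ :=
  Nat.card {p : (Fin (a + k - 1) → ZMod 2) × (Fin (b + k - 1) → ZMod 2) //
    (Matrix.fromRows (hankel a k p.1) (hankel b k p.2)).rank = i}

section

open Polynomial Finset
open scoped Classical

/-- A triple of binary polynomials generating the unit ideal. -/
def Unimodular (z : (ZMod 2)[X] × (ZMod 2)[X] × (ZMod 2)[X]) : Prop :=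
  ∃ r s t, r * z.1 + s * z.2.1 + t * z.2.2 = 1

lemma binary_monic {p : (ZMod 2)[X]} (hp : p ≠ 0) : p.Monic := by
  have h : ∀ c : ZMod 2, c ≠ 0 → c = 1 := by decide
  exact h _ (leadingCoeff_ne_zero.mpr hp)

lemma binary_eq_of_dvd_dvd {p q : (ZMod 2)[X]} (hpq : p ∣ q) (hqp : q ∣ p) : p = q := by
  by_cases hp : p = 0
  · subst hp; exact (zero_dvd_iff.mp hpq).symm
  have hq : q ≠ 0 := fun h => hp (zero_dvd_iff.mp (h ▸ hqp))
  exact eq_of_monic_of_associated (binary_monic hp) (binary_monic hq)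
    (associated_of_dvd_dvd hpq hqp)

lemma exists_eq_smul_unimodular {z : (ZMod 2)[X] × (ZMod 2)[X] × (ZMod 2)[X]} (hz : z ≠ 0) :
    ∃ (h : (ZMod 2)[X]) (z' : (ZMod 2)[X] × (ZMod 2)[X] × (ZMod 2)[X]),
      h ≠ 0 ∧ Unimodular z' ∧ z = h • z' := by
  obtain ⟨x, y, w⟩ := z
  obtain ⟨h, hh⟩ := (IsPrincipalIdealRing.principal (Ideal.span {x, y, w})).principal
  rw [← Ideal.span] at hh
  have hd : ∀ p ∈ ({x, y, w} : Set (ZMod 2)[X]), h ∣ p := fun p hp =>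
    Ideal.mem_span_singleton.mp (hh ▸ Ideal.subset_span hp)
  obtain ⟨x', rfl⟩ := hd x (by simp)
  obtain ⟨y', rfl⟩ := hd y (by simp)
  obtain ⟨w', rfl⟩ := hd w (by simp)
  have h0 : h ≠ 0 := by
    rintro rfl
    simp at hz
  have hm : h ∈ Ideal.span {h * x', h * y', h * w'} := hh ▸ Ideal.mem_span_singleton_self h
  rw [Ideal.mem_span_insert] at hm
  obtain ⟨r, k, hk, hm⟩ := hm
  obtain ⟨s, t, rfl⟩ := Ideal.mem_span_pair.mp hk
  refine ⟨h, (x', y', w'), h0, ⟨r, s, t, ?_⟩, by simp⟩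
  apply mul_left_cancel₀ h0
  linear_combination -hm

lemma Unimodular.dvd_of_smul_eq {z z' : (ZMod 2)[X] × (ZMod 2)[X] × (ZMod 2)[X]}
    {h h' : (ZMod 2)[X]} (hz : Unimodular z) (e : h • z = h' • z') : h' ∣ h := by
  obtain ⟨r, s, t, hr⟩ := hz
  have e1 : h * z.1 = h' * z'.1 := congrArg Prod.fst e
  have e2 : h * z.2.1 = h' * z'.2.1 := congrArg (fun p => p.2.1) e
  have e3 : h * z.2.2 = h' * z'.2.2 := congrArg (fun p => p.2.2) e
  exact ⟨r * z'.1 + s * z'.2.1 + t * z'.2.2, by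
    linear_combination -h * hr + r * e1 + s * e2 + t * e3⟩

lemma Unimodular.smul_inj {z z' : (ZMod 2)[X] × (ZMod 2)[X] × (ZMod 2)[X]}
    {h h' : (ZMod 2)[X]} (hz : Unimodular z) (hz' : Unimodular z') (h0 : h ≠ 0)
    (e : h • z = h' • z') : h = h' ∧ z = z' := by
  have hh : h = h' := binary_eq_of_dvd_dvd (hz'.dvd_of_smul_eq e.symm) (hz.dvd_of_smul_eq e)
  subst hh
  refine ⟨rfl, Prod.ext ?_ (Prod.ext ?_ ?_)⟩ <;> apply mul_left_cancel₀ h0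
  · exact congrArg Prod.fst e
  · exact congrArg (fun p => p.2.1) e
  · exact congrArg (fun p => p.2.2) e

lemma Unimodular.eq_one_of_smul {z : (ZMod 2)[X] × (ZMod 2)[X] × (ZMod 2)[X]}
    {h : (ZMod 2)[X]} (hz : Unimodular (h • z)) : h = 1 := by
  obtain ⟨r, s, t, hr⟩ := hz
  simp only [Prod.smul_fst, Prod.smul_snd, smul_eq_mul] at hr
  exact binary_eq_of_dvd_dvd
    ⟨r * z.1 + s * z.2.1 + t * z.2.2, by linear_combination -hr⟩ (one_dvd _)

lemma degree_X_mul_add_C {h : (ZMod 2)[X]} (h0 : h ≠ 0) (c : ZMod 2) :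
    (X * h + C c).degree = h.degree + 1 := by
  have h1 : (X * h).degree = h.degree + 1 := by rw [degree_mul, degree_X, add_comm]
  rw [degree_add_eq_left_of_degree_lt, h1]
  rw [h1, degree_eq_natDegree h0]
  refine degree_C_lt.trans_le ?_
  exact_mod_cast Nat.le_add_left 1 _

lemma X_mul_add_C_ne_zero {h : (ZMod 2)[X]} (h0 : h ≠ 0) (c : ZMod 2) : X * h + C c ≠ 0 := by
  intro e
  have := degree_X_mul_add_C h0 c
  rw [e, degree_zero, degree_eq_natDegree h0] at this
  exact absurd this (by exact_mod_cast WithBot.bot_ne_coe)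

/-- Multiplying the content `h` of a triple by `X` and adding a constant parametrises the triples
with nontrivial content. -/
lemma sum_not_unimodular (S S' : Finset ((ZMod 2)[X] × (ZMod 2)[X] × (ZMod 2)[X]))
    (ω ω' : (ZMod 2)[X] × (ZMod 2)[X] × (ZMod 2)[X] → ℚ)
    (hS : ∀ z ∈ S, z ≠ 0) (hS' : ∀ z ∈ S', z ≠ 0)
    (hmem : ∀ (h : (ZMod 2)[X]) c z, h ≠ 0 → ((X * h + C c) • z ∈ S ↔ h • z ∈ S'))
    (hω : ∀ (h : (ZMod 2)[X]) c z, h ≠ 0 → h • z ∈ S' → ω ((X * h + C c) • z) = ω' (h • z)) :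
    ∑ z ∈ S with ¬ Unimodular z, ω z = 2 * ∑ z ∈ S', ω' z := by
  have key : ∀ z : (ZMod 2)[X] × (ZMod 2)[X] × (ZMod 2)[X],
      ∃ (h : (ZMod 2)[X]) (z' : (ZMod 2)[X] × (ZMod 2)[X] × (ZMod 2)[X]), z ≠ 0 →
        h ≠ 0 ∧ Unimodular z' ∧ z = h • z' := by
    intro z
    by_cases hz : z = 0
    · exact ⟨0, 0, fun h => absurd hz h⟩
    · obtain ⟨h, z', H⟩ := exists_eq_smul_unimodular hz
      exact ⟨h, z', fun _ => H⟩
  choose cont core hcc using key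
  have h2 : 2 * ∑ z ∈ S', ω' z = ∑ p ∈ (univ : Finset (ZMod 2)) ×ˢ S', ω' p.2 := by
    rw [sum_product]; simp [ZMod.card]
  rw [h2]
  symm
  refine sum_bij (fun p _ => (X * cont p.2 + C p.1) • core p.2) ?_ ?_ ?_ ?_
  · rintro ⟨c, y⟩ hy
    simp only [mem_product, mem_univ, true_and] at hy
    obtain ⟨h0, hu, e⟩ := hcc y (hS' y hy)
    rw [mem_filter]
    refine ⟨(hmem _ _ _ h0).mpr (e ▸ hy), fun hn => ?_⟩
    have h1 := hn.eq_one_of_smul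
    have h3 := degree_X_mul_add_C h0 c
    rw [h1, degree_one, degree_eq_natDegree h0] at h3
    have : (0 : ℕ) = (cont y).natDegree + 1 := by exact_mod_cast h3
    omega
  · rintro ⟨c, y⟩ hy ⟨c', y'⟩ hy' e
    simp only [mem_product, mem_univ, true_and] at hy hy' e
    obtain ⟨h0, hu, ey⟩ := hcc y (hS' y hy)
    obtain ⟨h0', hu', ey'⟩ := hcc y' (hS' y' hy')
    obtain ⟨e1, e2⟩ := hu.smul_inj hu' (X_mul_add_C_ne_zero h0 c) e
    have e3 : c = c' := by simpa using congrArg (coeff · 0) e1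
    subst e3
    rw [ey, ey', e2, mul_left_cancel₀ X_ne_zero (add_right_cancel e1)]
  · intro z hz
    rw [mem_filter] at hz
    obtain ⟨k, z', k0, hu, rfl⟩ := exists_eq_smul_unimodular (hS z hz.1)
    have hk : X * divX k + C (k.coeff 0) = k := X_mul_divX_add k
    have h0 : divX k ≠ 0 := by
      intro h
      rw [h, mul_zero, zero_add] at hk
      have hk1 : k.coeff 0 = 1 := by
        have : ∀ c : ZMod 2, c ≠ 0 → c = 1 := by decide
        exact this _ (fun h' => k0 (by rw [← hk, h', C_0]))
      rw [hk1, C_1] at hk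
      exact hz.2 (by rwa [← hk, one_smul])
    have hy : divX k • z' ∈ S' := (hmem _ (k.coeff 0) _ h0).mp (by rw [hk]; exact hz.1)
    refine ⟨(k.coeff 0, divX k • z'), by simpa using hy, ?_⟩
    obtain ⟨h0', hu', ey⟩ := hcc _ (hS' _ hy)
    obtain ⟨e1, e2⟩ := hu.smul_inj hu' h0 ey
    simp only
    rw [← e1, ← e2, hk]
  · rintro ⟨c, y⟩ hy
    simp only [mem_product, mem_univ, true_and] at hy
    obtain ⟨h0, hu, e⟩ := hcc y (hS' y hy)
    simp only
    rw [hω _ _ _ h0 (e ▸ hy), ← e]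

lemma sum_unimodular (S S' : Finset ((ZMod 2)[X] × (ZMod 2)[X] × (ZMod 2)[X]))
    (ω ω' : (ZMod 2)[X] × (ZMod 2)[X] × (ZMod 2)[X] → ℚ)
    (hS : ∀ z ∈ S, z ≠ 0) (hS' : ∀ z ∈ S', z ≠ 0)
    (hmem : ∀ (h : (ZMod 2)[X]) c z, h ≠ 0 → ((X * h + C c) • z ∈ S ↔ h • z ∈ S'))
    (hω : ∀ (h : (ZMod 2)[X]) c z, h ≠ 0 → h • z ∈ S' → ω ((X * h + C c) • z) = ω' (h • z)) :
    ∑ z ∈ S with Unimodular z, ω z = ∑ z ∈ S, ω z - 2 * ∑ z ∈ S', ω' z := by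
  rw [← sum_not_unimodular S S' ω ω' hS hS' hmem hω, ← sum_filter_add_sum_filter_not S Unimodular]
  ring

lemma card_unimodular (S S' : Finset ((ZMod 2)[X] × (ZMod 2)[X] × (ZMod 2)[X]))
    (hS : ∀ z ∈ S, z ≠ 0) (hS' : ∀ z ∈ S', z ≠ 0)
    (hmem : ∀ (h : (ZMod 2)[X]) c z, h ≠ 0 → ((X * h + C c) • z ∈ S ↔ h • z ∈ S')) :
    (#{z ∈ S | Unimodular z} : ℚ) = #S - 2 * #S' := by
  simpa using sum_unimodular S S' 1 1 hS hS' hmem (fun _ _ _ _ _ => rfl)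

noncomputable instance (n : ℕ) : Fintype (degreeLT (ZMod 2) n) :=
  Fintype.ofEquiv _ (degreeLTEquiv (ZMod 2) n).symm.toEquiv

lemma card_degreeLT (n : ℕ) : Nat.card (degreeLT (ZMod 2) n) = 2 ^ n := by
  rw [Nat.card_congr (degreeLTEquiv (ZMod 2) n).toEquiv]
  simp

/-- The binary polynomials of degree less than `n`. -/
noncomputable def polysLT (n : ℕ) : Finset (ZMod 2)[X] :=
  univ.map (Function.Embedding.subtype (· ∈ degreeLT (ZMod 2) n))

lemma mem_polysLT {n : ℕ} {p : (ZMod 2)[X]} : p ∈ polysLT n ↔ p.degree < n := by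
  simp [polysLT, mem_degreeLT]

lemma card_polysLT (n : ℕ) : #(polysLT n) = 2 ^ n := by
  rw [polysLT, card_map, card_univ, ← Nat.card_eq_fintype_card, card_degreeLT]

/-- The binary polynomials of degree `n`. -/
noncomputable def polysEq (n : ℕ) : Finset (ZMod 2)[X] :=
  (polysLT n).map (addRightEmbedding (X ^ n))

lemma mem_polysEq {n : ℕ} {p : (ZMod 2)[X]} : p ∈ polysEq n ↔ p.degree = n := by
  simp only [polysEq, mem_map, mem_polysLT, addRightEmbedding_apply]
  constructor
  · rintro ⟨q, hq, rfl⟩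
    rw [degree_add_eq_right_of_degree_lt, degree_X_pow]
    rwa [degree_X_pow]
  · intro hp
    refine ⟨p - X ^ n, ?_, by ring⟩
    have h0 : p ≠ 0 := by rintro rfl; simp at hp
    rw [← hp]
    refine degree_sub_lt_left ?_ h0 ?_
    · rw [hp, degree_X_pow]
    · rw [(binary_monic h0).leadingCoeff, (monic_X_pow n).leadingCoeff]

lemma card_polysEq (n : ℕ) : #(polysEq n) = 2 ^ n := by
  rw [polysEq, card_map, card_polysLT]

/-- Triples `(u, v, P)` representing a pair of proper fractions `u / P`, `v / P` with
denominator of degree `n`. -/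
noncomputable def fractions (n : ℕ) : Finset ((ZMod 2)[X] × (ZMod 2)[X] × (ZMod 2)[X]) :=
  polysLT n ×ˢ polysLT n ×ˢ polysEq n

/-- Triples `(f, g, w)` that can be a relation `f u + g v + w P = 0` on proper fractions, with
`deg f < a` and `deg g < b`. -/
noncomputable def relations (a b : ℕ) : Finset ((ZMod 2)[X] × (ZMod 2)[X] × (ZMod 2)[X]) :=
  {z ∈ polysLT a ×ˢ polysLT b ×ˢ polysLT (max a b) | z.2.2.degree < max z.1.degree z.2.1.degree}

lemma mem_fractions {n : ℕ} {z : (ZMod 2)[X] × (ZMod 2)[X] × (ZMod 2)[X]} :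
    z ∈ fractions n ↔ z.1.degree < n ∧ z.2.1.degree < n ∧ z.2.2.degree = n := by
  simp [fractions, mem_polysLT, mem_polysEq]

lemma mem_relations {a b : ℕ} {z : (ZMod 2)[X] × (ZMod 2)[X] × (ZMod 2)[X]} :
    z ∈ relations a b ↔ z.1.degree < a ∧ z.2.1.degree < b ∧
      z.2.2.degree < max z.1.degree z.2.1.degree := by
  simp only [relations, mem_filter, mem_product, mem_polysLT]
  refine ⟨fun h => ⟨h.1.1, h.1.2.1, h.2⟩, fun h => ⟨⟨h.1, h.2.1, h.2.2.trans ?_⟩, h.2.2⟩⟩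
  exact max_lt_max h.1 h.2.1

lemma fractions_ne_zero {n : ℕ} {z : (ZMod 2)[X] × (ZMod 2)[X] × (ZMod 2)[X]}
    (hz : z ∈ fractions n) : z ≠ 0 := by
  rintro rfl
  simp [mem_fractions] at hz

lemma relations_ne_zero {a b : ℕ} {z : (ZMod 2)[X] × (ZMod 2)[X] × (ZMod 2)[X]}
    (hz : z ∈ relations a b) : z ≠ 0 := by
  rintro rfl
  simp [mem_relations] at hz

lemma card_fractions (n : ℕ) : #(fractions n) = 2 ^ (3 * n) := by
  rw [fractions, card_product, card_product, card_polysLT, card_polysEq]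
  ring

lemma degree_X_mul_add_C_mul {h : (ZMod 2)[X]} (h0 : h ≠ 0) (c : ZMod 2) (p : (ZMod 2)[X]) :
    ((X * h + C c) * p).degree = (h * p).degree + 1 := by
  rw [degree_mul, degree_X_mul_add_C h0, degree_mul, add_right_comm]

lemma withBot_add_one_lt_add_one {x y : WithBot ℕ} : x + 1 < y + 1 ↔ x < y :=
  WithBot.add_lt_add_iff_right WithBot.one_ne_bot

lemma withBot_add_one_lt {x : WithBot ℕ} {n : ℕ} : x + 1 < (n + 1 : ℕ) ↔ x < n := by
  rw [Nat.cast_add, Nat.cast_one, withBot_add_one_lt_add_one]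

lemma withBot_add_one_eq {x : WithBot ℕ} {n : ℕ} : x + 1 = (n + 1 : ℕ) ↔ x = n := by
  rw [Nat.cast_add, Nat.cast_one, WithBot.add_right_inj WithBot.one_ne_bot]

lemma smul_mem_fractions {h : (ZMod 2)[X]} (h0 : h ≠ 0) (c : ZMod 2) (n : ℕ)
    (z : (ZMod 2)[X] × (ZMod 2)[X] × (ZMod 2)[X]) :
    (X * h + C c) • z ∈ fractions (n + 1) ↔ h • z ∈ fractions n := by
  simp only [mem_fractions, Prod.smul_fst, Prod.smul_snd, smul_eq_mul,
    degree_X_mul_add_C_mul h0, withBot_add_one_lt, withBot_add_one_eq]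

lemma smul_mem_relations {h : (ZMod 2)[X]} (h0 : h ≠ 0) (c : ZMod 2) (a b : ℕ)
    (z : (ZMod 2)[X] × (ZMod 2)[X] × (ZMod 2)[X]) :
    (X * h + C c) • z ∈ relations (a + 1) (b + 1) ↔ h • z ∈ relations a b := by
  simp only [mem_relations, Prod.smul_fst, Prod.smul_snd, smul_eq_mul,
    degree_X_mul_add_C_mul h0, withBot_add_one_lt, max_add_add_right,
    withBot_add_one_lt_add_one]

lemma card_unimodular_fractions (n : ℕ) :
    (#{z ∈ fractions (n + 1) | Unimodular z} : ℚ) = 6 * 2 ^ (3 * n) := by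
  rw [card_unimodular (fractions (n + 1)) (fractions n) (fun _ => fractions_ne_zero)
    (fun _ => fractions_ne_zero) (fun h c z h0 => smul_mem_fractions h0 c n z),
    card_fractions, card_fractions]
  push_cast
  ring

/-- The degree of the leading part `(f, g)` of a relation `(f, g, w)`. -/
noncomputable def relationDegree (z : (ZMod 2)[X] × (ZMod 2)[X] × (ZMod 2)[X]) : ℕ :=
  max z.1.natDegree z.2.1.natDegree

lemma cast_relationDegree {z : (ZMod 2)[X] × (ZMod 2)[X] × (ZMod 2)[X]}
    (hz : z.1 ≠ 0 ∨ z.2.1 ≠ 0) :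
    (relationDegree z : WithBot ℕ) = max z.1.degree z.2.1.degree := by
  obtain ⟨f, g, w⟩ := z
  simp only [relationDegree] at hz ⊢
  by_cases hf : f = 0
  · subst hf
    rw [degree_eq_natDegree (hz.resolve_left (by simp))]
    simp
  by_cases hg : g = 0
  · subst hg
    rw [degree_eq_natDegree hf]
    simp
  rw [degree_eq_natDegree hf, degree_eq_natDegree hg]
  exact WithBot.coe_max _ _

lemma ne_zero_of_mem_relations {a b : ℕ} {z : (ZMod 2)[X] × (ZMod 2)[X] × (ZMod 2)[X]}
    (hz : z ∈ relations a b) : z.1 ≠ 0 ∨ z.2.1 ≠ 0 := by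
  by_contra! h
  have := (mem_relations.mp hz).2.2
  simp [h.1, h.2] at this

lemma relationDegree_smul {a b : ℕ} {h : (ZMod 2)[X]} (h0 : h ≠ 0) (c : ZMod 2)
    (z : (ZMod 2)[X] × (ZMod 2)[X] × (ZMod 2)[X]) (hz : h • z ∈ relations a b) :
    relationDegree ((X * h + C c) • z) = relationDegree (h • z) + 1 := by
  have h1 := cast_relationDegree (ne_zero_of_mem_relations hz)
  have h2 := cast_relationDegree
    (ne_zero_of_mem_relations ((smul_mem_relations h0 c a b z).mpr hz))
  simp only [Prod.smul_fst, Prod.smul_snd, smul_eq_mul, degree_X_mul_add_C_mul h0,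
    max_add_add_right] at h1 h2
  rw [← h1] at h2
  exact_mod_cast h2

lemma sum_relations (a b : ℕ) :
    ∑ z ∈ relations a b, (1 / 2 : ℚ) ^ relationDegree z = 2 ^ (a + b) - 1 := by
  have inner : ∀ f ∈ polysLT a, ∀ g ∈ polysLT b,
      (∑ w ∈ polysLT (max a b), if w.degree < max f.degree g.degree then
        (1 / 2 : ℚ) ^ relationDegree (f, g, w) else 0) = 1 - if f = 0 ∧ g = 0 then 1 else 0 := by
    intro f hf g hg
    rw [mem_polysLT] at hf hg
    by_cases h0 : f = 0 ∧ g = 0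
    · simp [h0]
    · have h1 : f ≠ 0 ∨ g ≠ 0 := by tauto
      have h2 : ∀ w, (relationDegree (f, g, w) : WithBot ℕ) = max f.degree g.degree :=
        fun w => cast_relationDegree (z := (f, g, w)) h1
      have h3 : {w ∈ polysLT (max a b) | w.degree < max f.degree g.degree} =
          polysLT (relationDegree (f, g, 0)) := by
        ext w
        simp only [mem_filter, mem_polysLT, h2]
        refine ⟨fun h => h.2, fun h => ⟨h.trans ?_, h⟩⟩
        exact max_lt_max hf hg
      rw [← sum_filter, h3, if_neg h0]
      simp only [relationDegree, sum_const, card_polysLT, nsmul_eq_mul]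
      push_cast
      rw [← mul_pow]
      norm_num
  rw [relations, sum_filter, sum_product]
  simp only [sum_product]
  rw [sum_congr rfl fun f hf => sum_congr rfl fun g hg => inner f hf g hg]
  have h0 : ∀ n, (0 : (ZMod 2)[X]) ∈ polysLT n := fun n => by simp [mem_polysLT]
  simp [ite_and, sum_sub_distrib, card_polysLT, h0, pow_add]

lemma sum_unimodular_relations (a b : ℕ) :
    ∑ z ∈ relations (a + 1) (b + 1) with Unimodular z, (1 / 2 : ℚ) ^ relationDegree z =
      3 * 2 ^ (a + b) := by
  rw [sum_unimodular _ (relations a b) _ (fun z => (1 / 2 : ℚ) ^ (relationDegree z + 1))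
    (fun _ => relations_ne_zero) (fun _ => relations_ne_zero)
    (fun h c z h0 => smul_mem_relations h0 c a b z)
    (fun h c z h0 hz => by rw [relationDegree_smul h0 c z hz])]
  simp only [pow_succ, ← sum_mul]
  rw [sum_relations, sum_relations]
  ring

/-- The relation `z` annihilates the triple `x`. -/
def Annihilates (z x : (ZMod 2)[X] × (ZMod 2)[X] × (ZMod 2)[X]) : Prop :=
  z.1 * x.1 + z.2.1 * x.2.1 + z.2.2 * x.2.2 = 0

lemma monic_of_degree_eq {P : (ZMod 2)[X]} {n : ℕ} (hP : P.degree = n) : P.Monic := by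
  refine binary_monic ?_
  rintro rfl
  rw [degree_zero] at hP
  exact WithBot.natCast_ne_bot _ hP.symm

lemma modByMonic_eq_modByMonic_iff {f p q : (ZMod 2)[X]} (hf : f.Monic) :
    p %ₘ f = q %ₘ f ↔ f ∣ p - q := by
  rw [← sub_eq_zero, ← sub_modByMonic, modByMonic_eq_zero_iff_dvd hf]

lemma card_annihilated_of_degree_le {f g w : (ZMod 2)[X]} (hu : Unimodular (f, g, w))
    (hf : f ≠ 0) (hg : g.degree ≤ f.degree) (hw : w.degree < f.degree) {n : ℕ}
    (hn : f.natDegree ≤ n) :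
    #{x ∈ fractions n | Annihilates (f, g, w) x} * 2 ^ f.natDegree = 2 ^ (2 * n) := by
  have hm := binary_monic hf
  have hdf := degree_eq_natDegree hf
  have hlt : ∀ p : (ZMod 2)[X], p %ₘ f ∈ degreeLT (ZMod 2) f.natDegree := fun p => by
    rw [mem_degreeLT, ← hdf]; exact degree_modByMonic_lt p hm
  let L : degreeLT (ZMod 2) n × degreeLT (ZMod 2) n →ₗ[ZMod 2] degreeLT (ZMod 2) f.natDegree :=
    ((modByMonicHom f).comp
      (((LinearMap.mulLeft (ZMod 2) g).comp (degreeLT (ZMod 2) n).subtype).coprod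
        ((LinearMap.mulLeft (ZMod 2) w).comp (degreeLT (ZMod 2) n).subtype))).codRestrict _
      (fun x => hlt _)
  have hL : ∀ x, (L x : (ZMod 2)[X]) = (g * (x.1 : (ZMod 2)[X]) + w * (x.2 : (ZMod 2)[X])) %ₘ f :=
    fun x => rfl
  have hsurj : Function.Surjective L := by
    rintro ⟨y, hy⟩
    rw [mem_degreeLT, ← hdf] at hy
    obtain ⟨r, s, t, hrst⟩ := hu
    have hn' : ∀ p : (ZMod 2)[X], p %ₘ f ∈ degreeLT (ZMod 2) n := fun p =>
      degreeLT_mono hn (hlt p)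
    refine ⟨(⟨(y * s) %ₘ f, hn' _⟩, ⟨(y * t) %ₘ f, hn' _⟩), Subtype.ext ?_⟩
    rw [hL]
    simp only at hrst ⊢
    conv_rhs => rw [← (modByMonic_eq_self_iff hm).mpr hy]
    rw [modByMonic_eq_modByMonic_iff hm]
    refine ⟨-(y * r + g * (y * s /ₘ f) + w * (y * t /ₘ f)), ?_⟩
    linear_combination g * modByMonic_add_div (y * s) f + w * modByMonic_add_div (y * t) f
      + y * hrst
  have hfib : ∀ y y', #{x | L x = y} = #{x | L x = y'} := fun y y' =>
    AddMonoidHom.card_fiber_eq_of_mem_range L (hsurj y) (hsurj y')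
  set y0 : degreeLT (ZMod 2) f.natDegree := ⟨-(w * X ^ n) %ₘ f, hlt _⟩ with hy0
  have hcard : #{x | L x = y0} * 2 ^ f.natDegree = 2 ^ (2 * n) := by
    have h1 : ∑ y : degreeLT (ZMod 2) f.natDegree, #{x | L x = y} = 2 ^ (2 * n) := by
      rw [← card_eq_sum_card_fiberwise (fun _ _ => mem_univ _), card_univ, Fintype.card_prod,
        ← Nat.card_eq_fintype_card, card_degreeLT]
      ring
    rw [sum_congr rfl (fun y _ => hfib y y0), sum_const, card_univ, ← Nat.card_eq_fintype_card,
      card_degreeLT, smul_eq_mul, mul_comm] at h1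
    exact h1
  rw [← hcard]
  congr 1
  symm
  have hval : ∀ x, L x = y0 ↔ f ∣ g * (x.1 : (ZMod 2)[X]) + w * ((x.2 : (ZMod 2)[X]) + X ^ n) := by
    intro x
    rw [Subtype.ext_iff, hL, hy0, modByMonic_eq_modByMonic_iff hm]
    ring_nf
  refine card_bij (fun x _ =>
    (-((g * (x.1 : (ZMod 2)[X]) + w * ((x.2 : (ZMod 2)[X]) + X ^ n)) /ₘ f),
    (x.1 : (ZMod 2)[X]), (x.2 : (ZMod 2)[X]) + X ^ n)) ?_ ?_ ?_
  · intro x hx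
    rw [mem_filter, hval] at hx
    obtain ⟨q, hq⟩ := hx.2
    have hv := mem_degreeLT.mp x.1.2
    have hP : ((x.2 : (ZMod 2)[X]) + X ^ n).degree = (n : WithBot ℕ) :=
      mem_polysEq.mp (mem_map.mpr ⟨_, mem_polysLT.mpr (mem_degreeLT.mp x.2.2), rfl⟩)
    rw [hq, mul_divByMonic_cancel_left _ hm, mem_filter, mem_fractions]
    refine ⟨⟨?_, hv, hP⟩, ?_⟩
    · simp only [degree_neg]
      by_contra! hc
      have h1 : (f * q).degree < f.degree + n := by
        rw [← hq]
        refine (degree_add_le _ _).trans_lt (max_lt ?_ ?_)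
        · rw [degree_mul]
          exact (add_le_add_left hg _).trans_lt
            (WithBot.add_lt_add_left (degree_eq_bot.not.mpr hf) hv)
        · rw [degree_mul, hP]
          exact WithBot.add_lt_add_right (WithBot.natCast_ne_bot n) hw
      rw [degree_mul] at h1
      exact absurd h1 (not_lt.mpr (by gcongr))
    · simp only [Annihilates]
      linear_combination hq
  · intro x hx y hy e
    simp only [Prod.mk.injEq, add_left_inj] at e
    exact Prod.ext (Subtype.ext e.2.1) (Subtype.ext e.2.2)
  · rintro ⟨u, v, P⟩ hx
    rw [mem_filter, mem_fractions] at hx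
    obtain ⟨⟨hu, hv, hP⟩, hx⟩ := hx
    simp only [Annihilates] at hu hv hP hx
    have hP' : P - X ^ n ∈ degreeLT (ZMod 2) n := by
      obtain ⟨q, hq, rfl⟩ := mem_map.mp (mem_polysEq.mpr hP)
      simpa [mem_degreeLT] using mem_polysLT.mp hq
    have hq : g * v + w * P = f * -u := by linear_combination hx
    refine ⟨(⟨v, mem_degreeLT.mpr hv⟩, ⟨P - X ^ n, hP'⟩), ?_, ?_⟩
    · rw [mem_filter, hval]
      exact ⟨mem_univ _, -u, by simpa using hq⟩
    · simp only [sub_add_cancel, hq, mul_divByMonic_cancel_left _ hm, neg_neg]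

lemma card_annihilated {z : (ZMod 2)[X] × (ZMod 2)[X] × (ZMod 2)[X]} {a b n : ℕ}
    (hz : z ∈ relations a b) (hu : Unimodular z) (hn : relationDegree z ≤ n) :
    (#{x ∈ fractions n | Annihilates z x} : ℚ) = 2 ^ (2 * n) * (1 / 2) ^ relationDegree z := by
  have key : #{x ∈ fractions n | Annihilates z x} * 2 ^ relationDegree z = 2 ^ (2 * n) := by
    have hz0 := ne_zero_of_mem_relations hz
    have hw := (mem_relations.mp hz).2.2
    obtain ⟨f, g, w⟩ := z
    simp only [relationDegree] at hz0 hw hn ⊢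
    rcases le_total g.degree f.degree with h | h
    · rw [max_eq_left h] at hw
      rw [max_eq_left (natDegree_le_natDegree h)] at hn ⊢
      exact card_annihilated_of_degree_le hu (fun hf => by simp [hf] at hw) h hw hn
    · rw [max_eq_right h] at hw
      rw [max_eq_right (natDegree_le_natDegree h)] at hn ⊢
      have hu' : Unimodular (g, f, w) := by
        obtain ⟨r, s, t, e⟩ := hu
        exact ⟨s, r, t, by linear_combination e⟩
      rw [← card_annihilated_of_degree_le hu' (fun hf => by simp [hf] at hw) h hw hn]
      congr 1
      refine card_nbij' (fun x => (x.2.1, x.1, x.2.2)) (fun x => (x.2.1, x.1, x.2.2)) ?_ ?_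
        (fun _ _ => rfl) (fun _ _ => rfl)
      all_goals
        intro x hx
        rw [mem_coe, mem_filter, mem_fractions] at hx ⊢
        simp only [Annihilates] at hx ⊢
        exact ⟨⟨hx.1.2.1, hx.1.1, hx.1.2.2⟩, by linear_combination hx.2⟩
  have key' : (#{x ∈ fractions n | Annihilates z x} : ℚ) * 2 ^ relationDegree z = 2 ^ (2 * n) := by
    exact_mod_cast key
  rw [← key', mul_assoc, ← mul_pow]
  norm_num

lemma annihilates_smul_right {z x : (ZMod 2)[X] × (ZMod 2)[X] × (ZMod 2)[X]} {k : (ZMod 2)[X]}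
    (hk : k ≠ 0) : Annihilates z (k • x) ↔ Annihilates z x := by
  simp only [Annihilates, Prod.smul_fst, Prod.smul_snd, smul_eq_mul]
  rw [show z.1 * (k * x.1) + z.2.1 * (k * x.2.1) + z.2.2 * (k * x.2.2) =
    k * (z.1 * x.1 + z.2.1 * x.2.1 + z.2.2 * x.2.2) by ring, mul_eq_zero, or_iff_right hk]

lemma annihilates_smul_left {z x : (ZMod 2)[X] × (ZMod 2)[X] × (ZMod 2)[X]} {k : (ZMod 2)[X]}
    (hk : k ≠ 0) : Annihilates (k • z) x ↔ Annihilates z x := by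
  simp only [Annihilates, Prod.smul_fst, Prod.smul_snd, smul_eq_mul]
  rw [show k * z.1 * x.1 + k * z.2.1 * x.2.1 + k * z.2.2 * x.2.2 =
    k * (z.1 * x.1 + z.2.1 * x.2.1 + z.2.2 * x.2.2) by ring, mul_eq_zero, or_iff_right hk]

lemma card_unimodular_annihilated {z : (ZMod 2)[X] × (ZMod 2)[X] × (ZMod 2)[X]} {a b n : ℕ}
    (hz : z ∈ relations a b) (hu : Unimodular z) (hn : relationDegree z ≤ n) :
    (#{x ∈ fractions (n + 1) | Annihilates z x ∧ Unimodular x} : ℚ) =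
      2 ^ (2 * n + 1) * (1 / 2) ^ relationDegree z := by
  rw [← filter_filter, card_unimodular _ {x ∈ fractions n | Annihilates z x}
    (fun x hx => fractions_ne_zero (mem_filter.mp hx).1)
    (fun x hx => fractions_ne_zero (mem_filter.mp hx).1),
    card_annihilated hz hu hn, card_annihilated hz hu (hn.trans (Nat.le_add_right n 1))]
  · ring
  · intro h c x h0
    rw [mem_filter, mem_filter, smul_mem_fractions h0, annihilates_smul_right h0,
      annihilates_smul_right (X_mul_add_C_ne_zero h0 c)]

/-- The fractions `u / P`, `v / P` satisfy no nonzero relation with `deg f < a`, `deg g < b`. -/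
def Independent (a b : ℕ) (x : (ZMod 2)[X] × (ZMod 2)[X] × (ZMod 2)[X]) : Prop :=
  ∀ f g : (ZMod 2)[X], f.degree < a → g.degree < b → x.2.2 ∣ f * x.1 + g * x.2.1 → f = 0 ∧ g = 0

lemma Independent.unimodular {a b : ℕ} {x : (ZMod 2)[X] × (ZMod 2)[X] × (ZMod 2)[X]}
    (hx : x ∈ fractions (a + b)) (h : Independent a b x) : Unimodular x := by
  obtain ⟨u, v, P⟩ := x
  have hP : P.degree = (a + b : ℕ) := (mem_fractions.mp hx).2.2
  have hm : P.Monic := monic_of_degree_eq hP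
  have hlt : ∀ p : (ZMod 2)[X], p %ₘ P ∈ degreeLT (ZMod 2) (a + b) := fun p => by
    rw [mem_degreeLT, ← hP]; exact degree_modByMonic_lt p hm
  let L : degreeLT (ZMod 2) a × degreeLT (ZMod 2) b →ₗ[ZMod 2] degreeLT (ZMod 2) (a + b) :=
    ((modByMonicHom P).comp
      (((LinearMap.mulRight (ZMod 2) u).comp (degreeLT (ZMod 2) a).subtype).coprod
        ((LinearMap.mulRight (ZMod 2) v).comp (degreeLT (ZMod 2) b).subtype))).codRestrict _
      (fun x => hlt _)
  have hL : ∀ y, (L y : (ZMod 2)[X]) =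
    ((y.1 : (ZMod 2)[X]) * u + (y.2 : (ZMod 2)[X]) * v) %ₘ P := fun y => rfl
  have hinj : Function.Injective L := by
    rw [← LinearMap.ker_eq_bot, LinearMap.ker_eq_bot']
    intro y hy
    have hy' := congrArg Subtype.val hy
    rw [hL, ZeroMemClass.coe_zero, modByMonic_eq_zero_iff_dvd hm] at hy'
    obtain ⟨h1, h2⟩ := h _ _ (mem_degreeLT.mp y.1.2) (mem_degreeLT.mp y.2.2) hy'
    exact Prod.ext (Subtype.ext h1) (Subtype.ext h2)
  have hbij : Function.Bijective L := by
    rw [Fintype.bijective_iff_injective_and_card]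
    refine ⟨hinj, ?_⟩
    rw [Fintype.card_prod]
    simp only [← Nat.card_eq_fintype_card, card_degreeLT, pow_add]
  obtain ⟨y, hy⟩ := hbij.2 ⟨1 %ₘ P, hlt 1⟩
  have hy' := congrArg Subtype.val hy
  rw [hL] at hy'
  simp only at hy'
  rw [modByMonic_eq_modByMonic_iff hm] at hy'
  obtain ⟨q, hq⟩ := hy'
  exact ⟨y.1, y.2, -q, by simp only; linear_combination hq⟩

lemma degree_mul_lt {p q : (ZMod 2)[X]} {a b : ℕ} (hp : p.degree < a) (hq : q.degree < b) :
    (p * q).degree < (a + b : ℕ) := by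
  by_cases h : p = 0
  · simp [h]
  rw [degree_mul, Nat.cast_add]
  exact (WithBot.add_lt_add_left (degree_eq_bot.not.mpr h) hq).trans
    (WithBot.add_lt_add_right (WithBot.natCast_ne_bot b) hp)

lemma eq_of_annihilates {a b : ℕ} {x z z' : (ZMod 2)[X] × (ZMod 2)[X] × (ZMod 2)[X]}
    (hx : x ∈ fractions (a + b)) (hux : Unimodular x) (hz : z ∈ relations a b)
    (hz' : z' ∈ relations a b) (hu : Unimodular z) (hu' : Unimodular z')
    (h : Annihilates z x) (h' : Annihilates z' x) : z = z' := by
  have hP := (mem_fractions.mp hx).2.2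
  obtain ⟨hfa, hgb, -⟩ := mem_relations.mp hz
  obtain ⟨hfa', hgb', -⟩ := mem_relations.mp hz'
  obtain ⟨u, v, P⟩ := x
  obtain ⟨f, g, w⟩ := z
  obtain ⟨f', g', w'⟩ := z'
  simp only [Annihilates] at hP hfa hgb hfa' hgb' h h'
  have hP0 : P ≠ 0 := (monic_of_degree_eq hP).ne_zero
  have hdet : f * g' - f' * g = 0 := by
    apply eq_zero_of_dvd_of_degree_lt (p := P)
    · obtain ⟨r, s, t, e⟩ := hux
      simp only at e
      refine ⟨r * (g * w' - g' * w) + s * (f' * w - f * w') + t * (f * g' - f' * g), ?_⟩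
      linear_combination -(f * g' - f' * g) * e + (r * g' - s * f') * h + (s * f - r * g) * h'
    · rw [hP]
      exact (degree_sub_le _ _).trans_lt (max_lt (degree_mul_lt hfa hgb') (degree_mul_lt hfa' hgb))
  have hfw : w * f' - w' * f = 0 := by
    apply mul_left_cancel₀ hP0
    linear_combination f' * h - f * h' + v * hdet
  have hgw : w * g' - w' * g = 0 := by
    apply mul_left_cancel₀ hP0
    linear_combination g' * h - g * h' - u * hdet
  obtain ⟨r, s, t, e⟩ := hu
  simp only at e
  have hc : (f', g', w') = (r * f' + s * g' + t * w') • (f, g, w) := by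
    simp only [Prod.smul_mk, smul_eq_mul, Prod.mk.injEq]
    refine ⟨?_, ?_, ?_⟩
    · linear_combination -f' * e - s * hdet + t * hfw
    · linear_combination -g' * e + r * hdet + t * hgw
    · linear_combination -w' * e - r * hfw - s * hgw
  rw [hc] at hu' ⊢
  rw [hu'.eq_one_of_smul, one_smul]

lemma exists_annihilates {a b n : ℕ} {x : (ZMod 2)[X] × (ZMod 2)[X] × (ZMod 2)[X]}
    (hx : x ∈ fractions n) (h : ¬ Independent a b x) :
    ∃ z ∈ relations a b, Unimodular z ∧ Annihilates z x := by
  obtain ⟨hu, hv, hP⟩ := mem_fractions.mp hx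
  obtain ⟨u, v, P⟩ := x
  simp only [Independent, not_forall] at h
  obtain ⟨f, g, hf, hg, ⟨w, hw⟩, h0⟩ := h
  simp only at hu hv hP
  have h0' : f ≠ 0 ∨ g ≠ 0 := by tauto
  have hz : (f, g, -w) ∈ relations a b := by
    rw [mem_relations]
    refine ⟨hf, hg, ?_⟩
    simp only [degree_neg]
    have key : ∀ p q : (ZMod 2)[X], p.degree ≤ max f.degree g.degree → q.degree < n →
        (p * q).degree < max f.degree g.degree + n := by
      intro p q hp hq
      rw [degree_mul]
      refine (add_le_add_left hp _).trans_lt (WithBot.add_lt_add_left ?_ hq)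
      rw [← cast_relationDegree (z := (f, g, w)) h0']
      exact WithBot.natCast_ne_bot _
    have h1 : (P * w).degree < max f.degree g.degree + n := by
      rw [← hw]
      exact (degree_add_le _ _).trans_lt
        (max_lt (key f u (le_max_left _ _) hu) (key g v (le_max_right _ _) hv))
    rwa [degree_mul, hP, add_comm, WithBot.add_lt_add_iff_right (WithBot.natCast_ne_bot n)] at h1
  have ha : Annihilates (f, g, -w) (u, v, P) := by
    simp only [Annihilates]
    linear_combination hw
  obtain ⟨k, z, hk, hu, e⟩ := exists_eq_smul_unimodular (relations_ne_zero hz)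
  rw [e] at hz ha
  refine ⟨z, ?_, hu, (annihilates_smul_left hk).mp ha⟩
  rw [mem_relations] at hz ⊢
  simp only [Prod.smul_fst, Prod.smul_snd, smul_eq_mul, degree_mul, max_add_add_left] at hz
  have hle : ∀ d : WithBot ℕ, d ≤ k.degree + d := fun d =>
    le_add_of_nonneg_left (zero_le_degree_iff.mpr hk)
  exact ⟨(hle _).trans_lt hz.1, (hle _).trans_lt hz.2.1,
    (WithBot.add_lt_add_iff_left (degree_eq_bot.not.mpr hk)).mp hz.2.2⟩

lemma card_annihilating {a b : ℕ} {x : (ZMod 2)[X] × (ZMod 2)[X] × (ZMod 2)[X]}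
    (hx : x ∈ fractions (a + b)) (hu : Unimodular x) :
    #{z ∈ {z ∈ relations a b | Unimodular z} | Annihilates z x} =
      if Independent a b x then 0 else 1 := by
  split_ifs with h
  · rw [card_eq_zero, filter_eq_empty_iff]
    intro z hz ha
    rw [mem_filter] at hz
    obtain ⟨hf, hg, -⟩ := mem_relations.mp hz.1
    have h0 := h _ _ hf hg ⟨-z.2.2, by simp only [Annihilates] at ha; linear_combination ha⟩
    exact (ne_zero_of_mem_relations hz.1).elim (· h0.1) (· h0.2)
  · obtain ⟨z, hz, huz, ha⟩ := exists_annihilates hx h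
    rw [card_eq_one]
    refine ⟨z, ?_⟩
    ext z'
    simp only [mem_filter, mem_singleton]
    constructor
    · rintro ⟨⟨hz', hu'⟩, ha'⟩
      exact eq_of_annihilates hx hu hz' hz hu' huz ha' ha
    · rintro rfl
      exact ⟨⟨hz, huz⟩, ha⟩

lemma card_independent (a b : ℕ) :
    #{x ∈ fractions (a + 1 + (b + 1)) | Independent (a + 1) (b + 1) x} =
      3 * 2 ^ (3 * (a + b) + 3) := by
  set U := {x ∈ fractions (a + 1 + (b + 1)) | Unimodular x}
  have hI : {x ∈ fractions (a + 1 + (b + 1)) | Independent (a + 1) (b + 1) x} =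
      {x ∈ U | Independent (a + 1) (b + 1) x} := by
    ext x
    simp only [U, mem_filter]
    exact ⟨fun h => ⟨⟨h.1, h.2.unimodular h.1⟩, h.2⟩, fun h => ⟨h.1.1, h.2⟩⟩
  have hU : (#U : ℚ) = 6 * 2 ^ (3 * (a + b + 1)) := by
    rw [← card_unimodular_fractions, show a + b + 1 + 1 = a + 1 + (b + 1) by ring]
  have hbad : (#{x ∈ U | ¬ Independent (a + 1) (b + 1) x} : ℚ) = 3 * 2 ^ (3 * (a + b) + 3) := by
    have h1 : ∑ z ∈ relations (a + 1) (b + 1) with Unimodular z, #{x ∈ U | Annihilates z x} =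
        #{x ∈ U | ¬ Independent (a + 1) (b + 1) x} := by
      refine (sum_card_bipartiteAbove_eq_sum_card_bipartiteBelow Annihilates).trans ?_
      rw [card_filter]
      refine sum_congr rfl fun x hx => ?_
      rw [mem_filter] at hx
      rw [bipartiteBelow, card_annihilating hx.1 hx.2]
      split_ifs <;> simp_all
    rw [← h1, Nat.cast_sum]
    have h2 : ∀ z ∈ {z ∈ relations (a + 1) (b + 1) | Unimodular z},
        (#{x ∈ U | Annihilates z x} : ℚ) =
          2 ^ (2 * (a + b + 1) + 1) * (1 / 2) ^ relationDegree z := by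
      intro z hz
      rw [mem_filter] at hz
      rw [← card_unimodular_annihilated hz.1 hz.2, filter_filter,
        show a + b + 1 + 1 = a + 1 + (b + 1) by ring]
      · simp only [and_comm]
      · have h3 := cast_relationDegree (ne_zero_of_mem_relations hz.1)
        obtain ⟨hf, hg, -⟩ := mem_relations.mp hz.1
        have h4 := max_lt_max hf hg
        rw [← h3] at h4
        rcases lt_max_iff.mp h4 with h | h
        · have : relationDegree z < a + 1 := by exact_mod_cast h
          omega
        · have : relationDegree z < b + 1 := by exact_mod_cast h
          omega
    rw [sum_congr rfl h2, ← mul_sum, sum_unimodular_relations]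
    ring
  have hsum : (#{x ∈ U | Independent (a + 1) (b + 1) x} : ℚ) +
      #{x ∈ U | ¬ Independent (a + 1) (b + 1) x} = #U := by
    exact_mod_cast card_filter_add_card_filter_not _
  rw [hI]
  have : (#{x ∈ U | Independent (a + 1) (b + 1) x} : ℚ) = 3 * 2 ^ (3 * (a + b) + 3) := by
    rw [hbad, hU] at hsum
    linear_combination hsum
  exact_mod_cast this

/-- The coefficient of `X⁻¹` in the Laurent expansion of `p / P` at infinity. -/
noncomputable def residue (P : (ZMod 2)[X]) : (ZMod 2)[X] →ₗ[ZMod 2] ZMod 2 :=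
  (lcoeff (ZMod 2) (P.natDegree - 1)).comp (modByMonicHom P)

lemma residue_apply (P p : (ZMod 2)[X]) : residue P p = (p %ₘ P).coeff (P.natDegree - 1) := rfl

lemma residue_eq_zero_of_dvd {P p : (ZMod 2)[X]} (hP : P.Monic) (h : P ∣ p) : residue P p = 0 := by
  rw [residue_apply, (modByMonic_eq_zero_iff_dvd hP).mpr h, coeff_zero]

lemma dvd_of_residue_eq_zero {P p : (ZMod 2)[X]} (hP : P.Monic)
    (h : ∀ j < P.natDegree, residue P (X ^ j * p) = 0) : P ∣ p := by
  rw [← modByMonic_eq_zero_iff_dvd hP]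
  by_contra h0
  set r := p %ₘ P with hr
  have hlt : r.natDegree < P.natDegree :=
    natDegree_lt_natDegree h0 (degree_modByMonic_lt p hP)
  have hdeg : (X ^ (P.natDegree - 1 - r.natDegree) * r).degree < P.degree := by
    rw [degree_mul, degree_X_pow, degree_eq_natDegree h0, degree_eq_natDegree hP.ne_zero]
    norm_cast
    omega
  have h1 := h (P.natDegree - 1 - r.natDegree) (by omega)
  have h2 : (X ^ (P.natDegree - 1 - r.natDegree) * p) %ₘ P =
      X ^ (P.natDegree - 1 - r.natDegree) * r := by
    rw [← (modByMonic_eq_self_iff hP).mpr hdeg, modByMonic_eq_modByMonic_iff hP, ← mul_sub]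
    refine Dvd.dvd.mul_left ⟨p /ₘ P, ?_⟩ _
    linear_combination -modByMonic_add_div p P
  rw [residue_apply, h2, coeff_X_pow_mul', if_pos (by omega),
    show P.natDegree - 1 - (P.natDegree - 1 - r.natDegree) = r.natDegree by omega] at h1
  exact h0 (leadingCoeff_eq_zero.mp h1)

lemma residue_mul {f : (ZMod 2)[X]} {k : ℕ} (hf : f.degree < k) (P u : (ZMod 2)[X]) :
    residue P (f * u) = ∑ i : Fin k, f.coeff i * residue P (X ^ (i : ℕ) * u) := by
  have h : f = ∑ i : Fin k, C (f.coeff i) * X ^ (i : ℕ) := by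
    rw [Fin.sum_univ_eq_sum_range (fun i => C (f.coeff i) * X ^ i) k]
    ext j
    simp only [finsetSum_coeff, coeff_C_mul_X_pow]
    by_cases hj : j < k
    · simp [hj]
    · rw [coeff_eq_zero_of_degree_lt (hf.trans_le (by exact_mod_cast not_lt.mp hj))]
      simp [hj]
  conv_lhs => rw [h, sum_mul, map_sum]
  refine sum_congr rfl fun i _ => ?_
  rw [mul_assoc, ← smul_eq_C_mul, map_smul, smul_eq_mul]

lemma exists_residue_eq {P : (ZMod 2)[X]} (hP : P.Monic) (c : ℕ → ZMod 2) :
    ∃ u : (ZMod 2)[X], u.degree < P.natDegree ∧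
      ∀ j < P.natDegree, residue P (X ^ j * u) = c j := by
  set n := P.natDegree with hn
  let L : degreeLT (ZMod 2) n →ₗ[ZMod 2] (Fin n → ZMod 2) :=
    LinearMap.pi fun j => (residue P).comp
      ((LinearMap.mulLeft (ZMod 2) (X ^ (j : ℕ))).comp (degreeLT (ZMod 2) n).subtype)
  have hL : ∀ y j, L y j = residue P (X ^ (j : ℕ) * (y : (ZMod 2)[X])) := fun y j => rfl
  have hinj : Function.Injective L := by
    rw [← LinearMap.ker_eq_bot, LinearMap.ker_eq_bot']
    intro y hy
    have hdvd : P ∣ (y : (ZMod 2)[X]) := dvd_of_residue_eq_zero hP fun j hj => by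
      rw [← hL y ⟨j, hj⟩, hy, Pi.zero_apply]
    refine Subtype.ext (eq_zero_of_dvd_of_degree_lt hdvd ?_)
    rw [degree_eq_natDegree hP.ne_zero]
    exact mem_degreeLT.mp y.2
  have hbij : Function.Bijective L := by
    rw [Fintype.bijective_iff_injective_and_card]
    refine ⟨hinj, ?_⟩
    rw [← Nat.card_eq_fintype_card, card_degreeLT]
    simp
  obtain ⟨u, hu⟩ := hbij.2 fun j => c j
  exact ⟨u, mem_degreeLT.mp u.2, fun j hj => congrFun hu ⟨j, hj⟩⟩

/-- The stack of the `a × k` Hankel matrix of `α` over the `b × k` Hankel matrix of `β`. -/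
noncomputable def stackedHankel (a b k : ℕ) (α β : ℕ → ZMod 2) :
    Matrix (Fin a ⊕ Fin b) (Fin k) (ZMod 2) :=
  Matrix.of (Sum.elim (fun i j => α (i + j)) (fun i j => β (i + j)))

lemma fromRows_hankel (a b k : ℕ) (α β : ℕ → ZMod 2) :
    fromRows (hankel a k fun i => α i) (hankel b k fun i => β i) = stackedHankel a b k α β := by
  ext i j
  rcases i with i | i <;> rfl

lemma stackedHankel_mulVec_inl {a b k : ℕ} (α β : ℕ → ZMod 2) (c : Fin k → ZMod 2) (i : Fin a) :
    (stackedHankel a b k α β *ᵥ c) (Sum.inl i) = ∑ j : Fin k, α (i + j) * c j := rfl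

lemma stackedHankel_mulVec_inr {a b k : ℕ} (α β : ℕ → ZMod 2) (c : Fin k → ZMod 2) (i : Fin b) :
    (stackedHankel a b k α β *ᵥ c) (Sum.inr i) = ∑ j : Fin k, β (i + j) * c j := rfl

lemma stackedHankel_congr {a b k : ℕ} {α β α' β' : ℕ → ZMod 2}
    (h : ∀ j < a + k - 1, α j = α' j) (h' : ∀ j < b + k - 1, β j = β' j) :
    stackedHankel a b k α β = stackedHankel a b k α' β' := by
  ext i j
  rcases i with i | i
  · exact h _ (by omega)
  · exact h' _ (by omega)

lemma rank_eq_iff_vecMul {m n : Type*} [Fintype m] [Fintype n] (M : Matrix m n (ZMod 2)) :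
    M.rank = Fintype.card m ↔ ∀ y, y ᵥ* M = 0 → y = 0 := by
  have h : (∀ y, y ᵥ* M = 0 → y = 0) ↔ LinearIndependent (ZMod 2) M.row := by
    rw [← vecMul_injective_iff]
    exact (injective_iff_map_eq_zero M.vecMulLinear).symm
  rw [h, linearIndependent_iff_card_eq_finrank_span, rank_eq_finrank_span_row, eq_comm]
  rfl

lemma mulVec_bijective_of_rank_eq {m n : Type*} [Fintype m] [Fintype n]
    (M : Matrix m n (ZMod 2)) (hm : M.rank = Fintype.card m) (hn : M.rank = Fintype.card n) :
    Function.Bijective M.mulVec := by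
  have hsurj : Function.Surjective M.mulVecLin := by
    rw [← LinearMap.range_eq_top]
    apply Submodule.eq_top_of_finrank_eq
    rw [Module.finrank_fintype_fun_eq_card, ← hm]
    rfl
  refine ⟨?_, hsurj⟩
  refine (LinearMap.injective_iff_surjective_of_finrank_eq_finrank (f := M.mulVecLin) ?_).mpr hsurj
  rw [Module.finrank_fintype_fun_eq_card, Module.finrank_fintype_fun_eq_card, ← hm, ← hn]

/-- The power series coefficients of `u / P` at infinity. -/
noncomputable def expansion (P u : (ZMod 2)[X]) (j : ℕ) : ZMod 2 := residue P (X ^ j * u)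

lemma independent_iff_rank {a b : ℕ} {u v P : (ZMod 2)[X]} (hP : P.degree = (a + b : ℕ)) :
    Independent a b (u, v, P) ↔
      (stackedHankel a b (a + b) (expansion P u) (expansion P v)).rank = a + b := by
  have hm : P.Monic := monic_of_degree_eq hP
  have hdvd : ∀ f g : (ZMod 2)[X], f.degree < a → g.degree < b → (P ∣ f * u + g * v ↔
      Sum.elim (fun i : Fin a => f.coeff i) (fun i : Fin b => g.coeff i) ᵥ*
        stackedHankel a b (a + b) (expansion P u) (expansion P v) = 0) := by
    intro f g hf hg
    have hcol : ∀ j : Fin (a + b), (Sum.elim (fun i : Fin a => f.coeff i)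
        (fun i : Fin b => g.coeff i) ᵥ*
        stackedHankel a b (a + b) (expansion P u) (expansion P v)) j =
        residue P (X ^ (j : ℕ) * (f * u + g * v)) := by
      intro j
      rw [mul_add, map_add, mul_left_comm, mul_left_comm _ g, residue_mul hf, residue_mul hg]
      simp only [vecMul, dotProduct, Fintype.sum_sum_type, ← mul_assoc, ← pow_add]
      rfl
    constructor
    · intro h
      ext j
      rw [hcol, residue_eq_zero_of_dvd hm (h.mul_left _), Pi.zero_apply]
    · intro h
      refine dvd_of_residue_eq_zero hm fun j hj => ?_
      rw [natDegree_eq_of_degree_eq_some hP] at hj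
      rw [← hcol ⟨j, hj⟩, h, Pi.zero_apply]
  have hrank := rank_eq_iff_vecMul
    (stackedHankel a b (a + b) (expansion P u) (expansion P v))
  rw [Fintype.card_sum, Fintype.card_fin, Fintype.card_fin] at hrank
  rw [hrank]
  constructor
  · intro h y hy
    set f := (degreeLTEquiv (ZMod 2) a).symm (y ∘ Sum.inl) with hf
    set g := (degreeLTEquiv (ZMod 2) b).symm (y ∘ Sum.inr) with hg
    have hfy : ∀ i : Fin a, (f : (ZMod 2)[X]).coeff i = y (Sum.inl i) := fun i =>
      congrFun ((LinearEquiv.symm_apply_eq _).mp hf.symm).symm i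
    have hgy : ∀ i : Fin b, (g : (ZMod 2)[X]).coeff i = y (Sum.inr i) := fun i =>
      congrFun ((LinearEquiv.symm_apply_eq _).mp hg.symm).symm i
    have hy' : Sum.elim (fun i : Fin a => (f : (ZMod 2)[X]).coeff i)
        (fun i : Fin b => (g : (ZMod 2)[X]).coeff i) = y := by
      ext i
      rcases i with i | i
      · exact hfy i
      · exact hgy i
    obtain ⟨hf0, hg0⟩ := h f g (mem_degreeLT.mp f.2) (mem_degreeLT.mp g.2)
      ((hdvd f g (mem_degreeLT.mp f.2) (mem_degreeLT.mp g.2)).mpr (by rw [hy', hy]))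
    rw [← hy']
    ext i
    rcases i with i | i <;> simp [hf0, hg0]
  · intro h f g hf hg hfg
    have h0 := h _ ((hdvd f g hf hg).mp hfg)
    have hz : ∀ {p : (ZMod 2)[X]} {k : ℕ}, p.degree < k → (∀ i : Fin k, p.coeff i = 0) → p = 0 := by
      intro p k hp hc
      ext i
      by_cases hi : i < k
      · simpa using hc ⟨i, hi⟩
      · rw [coeff_eq_zero_of_degree_lt (hp.trans_le (by exact_mod_cast not_lt.mp hi)), coeff_zero]
    exact ⟨hz hf fun i => congrFun h0 (Sum.inl i), hz hg fun i => congrFun h0 (Sum.inr i)⟩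

lemma expansion_add (P u : (ZMod 2)[X]) (i j : ℕ) :
    expansion P u (i + j) = residue P (X ^ j * (X ^ i * u)) := by
  rw [expansion, pow_add]
  ring_nf

lemma degree_sub_X_pow_lt {P : (ZMod 2)[X]} {n : ℕ} (hP : P.degree = n) :
    (P - X ^ n).degree < (n : WithBot ℕ) := by
  obtain ⟨q, hq, rfl⟩ := mem_map.mp (mem_polysEq.mpr hP)
  simpa using mem_polysLT.mp hq

/-- Expansions of fractions with denominator `P` satisfy the linear recurrence given by `P`. -/
lemma sum_expansion {P : (ZMod 2)[X]} {n : ℕ} (hP : P.degree = n) (u : (ZMod 2)[X]) (i : ℕ) :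
    ∑ j : Fin n, expansion P u (i + j) * (P - X ^ n).coeff j = expansion P u (i + n) := by
  have hm : P.Monic := monic_of_degree_eq hP
  have h := residue_mul (degree_sub_X_pow_lt hP) P (X ^ i * u)
  rw [sub_mul, map_sub, residue_eq_zero_of_dvd hm (dvd_mul_right _ _), zero_sub,
    ← expansion_add, CharTwo.neg_eq] at h
  rw [h]
  refine sum_congr rfl fun j _ => ?_
  rw [expansion_add, mul_comm]

lemma eq_of_expansion_eq {P u u' : (ZMod 2)[X]} {n : ℕ} (hP : P.degree = n) (hu : u.degree < n)
    (hu' : u'.degree < n) (h : ∀ j < n, expansion P u j = expansion P u' j) : u = u' := by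
  have hm : P.Monic := monic_of_degree_eq hP
  rw [← sub_eq_zero]
  refine eq_zero_of_dvd_of_degree_lt (dvd_of_residue_eq_zero hm fun j hj => ?_)
    ((degree_sub_le _ _).trans_lt (hP ▸ max_lt hu hu'))
  rw [natDegree_eq_of_degree_eq_some hP] at hj
  rw [mul_sub, map_sub, sub_eq_zero]
  exact h j hj

/-- A pair of sequences whose stacked Hankel matrix is invertible consists of the expansions of
exactly one pair of fractions with common denominator of degree `a + b`. -/
lemma eq_of_expansion_eq_expansion {a b : ℕ} (ha : 0 < a) (hb : 0 < b)
    {x x' : (ZMod 2)[X] × (ZMod 2)[X] × (ZMod 2)[X]} (hx : x ∈ fractions (a + b))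
    (hx' : x' ∈ fractions (a + b)) (hi : Independent a b x)
    (h : ∀ j < a + (a + b), expansion x.2.2 x.1 j = expansion x'.2.2 x'.1 j)
    (h' : ∀ j < b + (a + b), expansion x.2.2 x.2.1 j = expansion x'.2.2 x'.2.1 j) : x = x' := by
  obtain ⟨hu, hv, hP⟩ := mem_fractions.mp hx
  obtain ⟨hu', hv', hP'⟩ := mem_fractions.mp hx'
  obtain ⟨u, v, P⟩ := x
  obtain ⟨u', v', P'⟩ := x'
  simp only at hu hv hP hu' hv' hP' h h'
  have hrank := (independent_iff_rank hP).mp hi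
  have hM := mulVec_bijective_of_rank_eq _ (by rw [hrank]; simp) (by rw [hrank]; simp)
  have hc : (fun j : Fin (a + b) => (P - X ^ (a + b)).coeff j) =
      fun j : Fin (a + b) => (P' - X ^ (a + b)).coeff j := by
    apply hM.1
    ext i
    rcases i with i | i
    · rw [stackedHankel_mulVec_inl, stackedHankel_mulVec_inl, sum_expansion hP, h _ (by omega),
        ← sum_expansion hP']
      exact sum_congr rfl fun j _ => by rw [h _ (by omega)]
    · rw [stackedHankel_mulVec_inr, stackedHankel_mulVec_inr, sum_expansion hP, h' _ (by omega),
        ← sum_expansion hP']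
      exact sum_congr rfl fun j _ => by rw [h' _ (by omega)]
  have hPP : P = P' := by
    rw [← sub_left_inj (a := X ^ (a + b))]
    ext j
    by_cases hj : j < a + b
    · exact congrFun hc ⟨j, hj⟩
    · have hj' : ((a + b : ℕ) : WithBot ℕ) ≤ j := by exact_mod_cast not_lt.mp hj
      rw [coeff_eq_zero_of_degree_lt ((degree_sub_X_pow_lt hP).trans_le hj'),
        coeff_eq_zero_of_degree_lt ((degree_sub_X_pow_lt hP').trans_le hj')]
  subst hPP
  rw [eq_of_expansion_eq hP hu hu' fun j hj => h j (by omega),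
    eq_of_expansion_eq hP hv hv' fun j hj => h' j (by omega)]

lemma exists_expansion_eq {P : (ZMod 2)[X]} {n N : ℕ} (hP : P.degree = n) (α : ℕ → ZMod 2)
    (hα : ∀ i < N, ∑ j : Fin n, α (i + j) * (P - X ^ n).coeff j = α (i + n)) :
    ∃ u : (ZMod 2)[X], u.degree < n ∧ ∀ j < N + n, expansion P u j = α j := by
  have hm : P.Monic := monic_of_degree_eq hP
  obtain ⟨u, hu, h⟩ := exists_residue_eq hm α
  rw [natDegree_eq_of_degree_eq_some hP] at hu h
  refine ⟨u, hu, fun j => ?_⟩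
  induction j using Nat.strong_induction_on with
  | _ j ih =>
    intro hj
    rcases lt_or_ge j n with hjn | hjn
    · exact h j hjn
    · obtain ⟨i, rfl⟩ := Nat.exists_eq_add_of_le' hjn
      rw [← sum_expansion hP, ← hα i (by omega)]
      exact sum_congr rfl fun k _ => by rw [ih _ (by omega) (by omega)]

lemma exists_fraction {a b : ℕ} {α β : ℕ → ZMod 2}
    (h : (stackedHankel a b (a + b) α β).rank = a + b) :
    ∃ x ∈ fractions (a + b), Independent a b x ∧
      (∀ j < a + (a + b), expansion x.2.2 x.1 j = α j) ∧
      ∀ j < b + (a + b), expansion x.2.2 x.2.1 j = β j := by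
  have hM := mulVec_bijective_of_rank_eq _ (by rw [h]; simp) (by rw [h]; simp)
  obtain ⟨c, hc⟩ := hM.2
    (Sum.elim (fun i : Fin a => α (i + (a + b))) fun i : Fin b => β (i + (a + b)))
  set q := (degreeLTEquiv (ZMod 2) (a + b)).symm c with hq
  have hqc : ∀ i : Fin (a + b), (q : (ZMod 2)[X]).coeff i = c i := fun i =>
    congrFun ((LinearEquiv.symm_apply_eq _).mp hq.symm).symm i
  set P : (ZMod 2)[X] := (q : (ZMod 2)[X]) + X ^ (a + b) with hPq
  have hP : P.degree = (a + b : ℕ) :=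
    mem_polysEq.mp (mem_map.mpr ⟨_, mem_polysLT.mpr (mem_degreeLT.mp q.2), rfl⟩)
  have hPc : ∀ i : Fin (a + b), (P - X ^ (a + b)).coeff i = c i := fun i => by
    rw [hPq, add_sub_cancel_right, hqc]
  obtain ⟨u, hu, hα⟩ := exists_expansion_eq (N := a) hP α fun i hi => by
    simp only [hPc]
    exact congrFun hc (Sum.inl ⟨i, hi⟩)
  obtain ⟨v, hv, hβ⟩ := exists_expansion_eq (N := b) hP β fun i hi => by
    simp only [hPc]
    exact congrFun hc (Sum.inr ⟨i, hi⟩)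
  refine ⟨(u, v, P), mem_fractions.mpr ⟨hu, hv, hP⟩, ?_, hα, hβ⟩
  rwa [independent_iff_rank hP, stackedHankel_congr (α' := α) (β' := β)
    (fun j hj => hα j (by omega)) (fun j hj => hβ j (by omega))]

/-- Extend a finite sequence by a constant. -/
def extend {N : ℕ} (α : Fin N → ZMod 2) (c : ZMod 2) (j : ℕ) : ZMod 2 :=
  if h : j < N then α ⟨j, h⟩ else c

lemma card_independent_eq_Gamma {a b : ℕ} (ha : 0 < a) (hb : 0 < b) :
    #{x ∈ fractions (a + b) | Independent a b x} = 4 * Gamma a b (a + b) (a + b) := by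
  let Φ : {x // x ∈ {x ∈ fractions (a + b) | Independent a b x}} →
      {p : (Fin (a + (a + b) - 1) → ZMod 2) × (Fin (b + (a + b) - 1) → ZMod 2) //
        (fromRows (hankel a (a + b) p.1) (hankel b (a + b) p.2)).rank = a + b} ×
        (ZMod 2 × ZMod 2) :=
    fun x => (⟨(fun i => expansion x.1.2.2 x.1.1 i, fun i => expansion x.1.2.2 x.1.2.1 i), by
      have h := mem_filter.mp x.2
      rw [fromRows_hankel, ← independent_iff_rank (mem_fractions.mp h.1).2.2]
      exact h.2⟩,
      expansion x.1.2.2 x.1.1 (a + (a + b) - 1), expansion x.1.2.2 x.1.2.1 (b + (a + b) - 1))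
  have hΦ : Function.Bijective Φ := by
    constructor
    · rintro ⟨x, hx⟩ ⟨x', hx'⟩ e
      simp only [Φ, Prod.mk.injEq, Subtype.mk.injEq] at e
      obtain ⟨⟨e1, e2⟩, e3, e4⟩ := e
      rw [mem_filter] at hx hx'
      refine Subtype.ext (eq_of_expansion_eq_expansion ha hb hx.1 hx'.1 hx.2 ?_ ?_)
      · intro j hj
        rcases Nat.lt_or_ge j (a + (a + b) - 1) with h | h
        · exact congrFun e1 ⟨j, h⟩
        · rwa [show j = a + (a + b) - 1 by omega]
      · intro j hj
        rcases Nat.lt_or_ge j (b + (a + b) - 1) with h | h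
        · exact congrFun e2 ⟨j, h⟩
        · rwa [show j = b + (a + b) - 1 by omega]
    · rintro ⟨⟨⟨α, β⟩, h⟩, c, d⟩
      have hα : α = fun i : Fin _ => extend α c i := by
        ext i
        simp [extend]
      have hβ : β = fun i : Fin _ => extend β d i := by
        ext i
        simp [extend]
      have h' := h
      simp only at h'
      rw [hα, hβ, fromRows_hankel] at h'
      obtain ⟨x, hx, hi, h1, h2⟩ := exists_fraction h'
      refine ⟨⟨x, mem_filter.mpr ⟨hx, hi⟩⟩, ?_⟩
      simp only [Φ, Prod.mk.injEq, Subtype.mk.injEq]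
      refine ⟨⟨?_, ?_⟩, ?_, ?_⟩
      · ext i
        rw [h1 _ (by omega)]
        simp [extend]
      · ext i
        rw [h2 _ (by omega)]
        simp [extend]
      · rw [h1 _ (by omega)]
        simp [extend]
      · rw [h2 _ (by omega)]
        simp [extend]
  rw [← Fintype.card_coe, ← Nat.card_eq_fintype_card, Nat.card_congr (Equiv.ofBijective Φ hΦ),
    Nat.card_prod, Gamma, mul_comm]
  simp

lemma Gamma_succ_succ (a b : ℕ) :
    Gamma (a + 1) (b + 1) (a + 1 + (b + 1)) (a + 1 + (b + 1)) = 3 * 2 ^ (3 * (a + b) + 1) := by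
  have h := card_independent_eq_Gamma (Nat.succ_pos a) (Nat.succ_pos b)
  have h' := card_independent a b
  rw [Nat.succ_eq_add_one, Nat.succ_eq_add_one, h', pow_add _ _ 3] at h
  rw [pow_add]
  omega

end

theorem Gamma_invertible_square (s m : ℕ) (hs : 2 ≤ s) :
    Gamma s (s + m) (2 * s + m) (2 * s + m) = 3 * 2 ^ (6 * s + 3 * m - 5) := by
  obtain ⟨a, rfl⟩ := Nat.exists_eq_add_of_le' (one_le_two.trans hs)
  have h := Gamma_succ_succ a (a + m)
  rwa [show a + 1 + (a + m + 1) = 2 * (a + 1) + m by ring, show a + m + 1 = a + 1 + m by ring,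
    show 3 * (a + (a + m)) + 1 = 6 * (a + 1) + 3 * m - 5 by omega] at h
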